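/- Let M be a model based on a rooted finitely M-generated descriptive frame F=(W,R,P) for K4.3, σ a signature, and b a σ-block in M. Then there exist clusters C⁻_b and C⁺_b of F such that: (a) b is the closed interval [C⁻_b, C⁺_b]; (b) if C⁺_b is maximal in M, then it is σ-maximal in M; (c) if C⁺_b is degenerate, then b = C⁺_b; (d) b is definable in M iff C⁺_b is not a limit cluster; (e) t^σ_M(b) = t^σ_M(C⁺_b), i.e., the σ-types realized in b are exactly those realized in C⁺_b. -/

import Mathlib

/-! ## Modal formulas -/

inductive MF : Type
  | var : ℕ → MF
  | top : MF
  | bot : MF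
  | neg : MF → MF
  | and : MF → MF → MF
  | dia : MF → MF
deriving DecidableEq

namespace MF

def or (φ ψ : MF) : MF := .neg (.and (.neg φ) (.neg ψ))
def imp (φ ψ : MF) : MF := MF.or (.neg φ) ψ
def box (φ : MF) : MF := .neg (.dia (.neg φ))
def diaPlus (φ : MF) : MF := MF.or φ (.dia φ)
def boxPlus (φ : MF) : MF := .and φ (box φ)

/-- the propositional variables occurring in a formula -/
def vars : MF → Finset ℕ
  | .var p => {p}
  | .top => ∅
  | .bot => ∅
  | .neg φ => vars φ
  | .and φ ψ => vars φ ∪ vars ψ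
  | .dia φ => vars φ

/-- the signature of a formula -/
def sig (φ : MF) : Set ℕ := ↑(vars φ)

/-- subformulas -/
def subs : MF → Finset MF
  | .var p => {.var p}
  | .top => {.top}
  | .bot => {.bot}
  | .neg φ => insert (.neg φ) (subs φ)
  | .and φ ψ => insert (.and φ ψ) (subs φ ∪ subs ψ)
  | .dia φ => insert (.dia φ) (subs φ)

/-- `|φ|`: the number of subformulas of `φ` together with their negations -/
def size (φ : MF) : ℕ := ((subs φ) ∪ (subs φ).image MF.neg).card

/-- uniform substitution -/
def substVar (s : ℕ → MF) : MF → MF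
  | .var p => s p
  | .top => .top
  | .bot => .bot
  | .neg φ => .neg (substVar s φ)
  | .and φ ψ => .and (substVar s φ) (substVar s ψ)
  | .dia φ => .dia (substVar s φ)

end MF

/-- a Boolean evaluation of modal formulas (treating `◇`-formulas and variables as atoms) -/
def BoolEval (f : MF → Prop) : Prop :=
  f .top ∧ ¬ f .bot ∧ (∀ φ, f (.neg φ) ↔ ¬ f φ) ∧ (∀ φ ψ, f (.and φ ψ) ↔ (f φ ∧ f ψ))

/-- Boolean tautologies in the modal language -/
def MF.Tautology (φ : MF) : Prop := ∀ f : MF → Prop, BoolEval f → f φ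

/-- normal modal logics -/
structure IsNormalLogic (L : Set MF) : Prop where
  taut : ∀ φ, φ.Tautology → φ ∈ L
  axK : MF.imp (MF.box (MF.imp (.var 0) (.var 1)))
          (MF.imp (MF.box (.var 0)) (MF.box (.var 1))) ∈ L
  mp : ∀ φ ψ, φ ∈ L → MF.imp φ ψ ∈ L → ψ ∈ L
  subst : ∀ φ s, φ ∈ L → MF.substVar s φ ∈ L
  nec : ∀ φ, φ ∈ L → MF.box φ ∈ L

/-- the smallest normal modal logic containing `Γ` -/
def NormClosure (Γ : Set MF) : Set MF :=
  {φ | ∀ L : Set MF, IsNormalLogic L → Γ ⊆ L → φ ∈ L}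

def ax4 : MF := MF.imp (MF.box (.var 0)) (MF.box (MF.box (.var 0)))
def ax43 : MF := MF.or (MF.box (MF.imp (MF.boxPlus (.var 0)) (.var 1)))
                       (MF.box (MF.imp (MF.boxPlus (.var 1)) (.var 0)))
def axGL : MF := MF.imp (MF.box (MF.imp (MF.box (.var 0)) (.var 0))) (MF.box (.var 0))

def K4 : Set MF := NormClosure {ax4}
def K43 : Set MF := NormClosure {ax4, ax43}
def GL3 : Set MF := NormClosure {ax4, ax43, axGL}

/-! ## General frames and models -/

/-- a (general) frame: a relation together with a collection of "internal" sets -/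
structure KFrame (W : Type) where
  R : W → W → Prop
  P : Set (Set W)

namespace KFrame

variable {W : Type}

def dia (F : KFrame W) (X : Set W) : Set W := {x | ∃ y ∈ X, F.R x y}

/-- the conditions making `F` a general frame -/
def IsGeneral (F : KFrame W) : Prop :=
  Nonempty W ∧ ∅ ∈ F.P ∧ Set.univ ∈ F.P ∧
    (∀ X ∈ F.P, ∀ Y ∈ F.P, X ∩ Y ∈ F.P) ∧
    (∀ X ∈ F.P, Xᶜ ∈ F.P) ∧ (∀ X ∈ F.P, F.dia X ∈ F.P)

/-- differentiated, tight and compact -/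
def Descriptive (F : KFrame W) : Prop :=
  (∀ x y : W, (∀ X ∈ F.P, x ∈ X ↔ y ∈ X) → x = y) ∧
  (∀ x y : W, F.R x y ↔ ∀ X ∈ F.P, y ∈ X → x ∈ F.dia X) ∧
  (∀ 𝒳 : Set (Set W), 𝒳 ⊆ F.P →
    (∀ 𝒴 : Set (Set W), 𝒴 ⊆ 𝒳 → 𝒴.Finite → (⋂₀ 𝒴).Nonempty) → (⋂₀ 𝒳).Nonempty)

/-- `x` is a root of `F` (every point is reachable from `x` via the reflexive closure) -/
def Rooted (F : KFrame W) (x : W) : Prop := ∀ y : W, x = y ∨ F.R x y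

/-- the strict order on clusters: `C(x) <_R C(y)` -/
def clLT (F : KFrame W) (x y : W) : Prop := F.R x y ∧ ¬ F.R y x

/-- the cluster of a point -/
def cluster (F : KFrame W) (x : W) : Set W := insert x {y | F.R x y ∧ F.R y x}

def clLE (F : KFrame W) (x y : W) : Prop := y ∈ F.cluster x ∨ F.clLT x y

/-- the closed interval of clusters `[C(x), C(y)]` -/
def interval (F : KFrame W) (x y : W) : Set W := {z | F.clLE x z ∧ F.clLE z y}

/-- `C(x)` is the final cluster -/
def FinalCl (F : KFrame W) (x : W) : Prop := ∀ y, ¬ F.clLT x y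

/-- `C(y)` is an immediate successor of `C(x)` -/
def ImmSucc (F : KFrame W) (x y : W) : Prop :=
  F.clLT x y ∧ ¬ ∃ z, F.clLT x z ∧ F.clLT z y

/-- `C(x)` is a limit cluster -/
def LimitCl (F : KFrame W) (x : W) : Prop := ¬ F.FinalCl x ∧ ¬ ∃ y, F.ImmSucc x y

/-- `C(x)` is a degenerate cluster -/
def DegenerateCl (F : KFrame W) (x : W) : Prop := ¬ F.R x x

end KFrame

/-- the closure of a family of sets under `∩`, complement and `◇` -/
inductive genBy {W : Type} (R : W → W → Prop) (G : Set (Set W)) : Set W → Prop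
  | basic {X : Set W} : X ∈ G → genBy R G X
  | empty : genBy R G ∅
  | univ : genBy R G Set.univ
  | inter {X Y : Set W} : genBy R G X → genBy R G Y → genBy R G (X ∩ Y)
  | compl {X : Set W} : genBy R G X → genBy R G Xᶜ
  | dia {X : Set W} : genBy R G X → genBy R G {x | ∃ y ∈ X, R x y}

def KFrame.GeneratedBy {W : Type} (F : KFrame W) (G : Set (Set W)) : Prop :=
  F.P = {X | genBy F.R G X}

def KFrame.FinGenerated {W : Type} (F : KFrame W) : Prop :=
  ∃ G : Set (Set W), G.Finite ∧ F.GeneratedBy G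

def KFrame.NGenerated {W : Type} (F : KFrame W) (n : ℕ) : Prop :=
  ∃ G : Set (Set W), G.Finite ∧ G.ncard = n ∧ F.GeneratedBy G

/-- a model: a frame with a valuation -/
structure KModel (W : Type) where
  F : KFrame W
  v : ℕ → Set W

namespace KModel

variable {W : Type}

/-- the frame is a general frame and all values of the valuation are internal -/
def IsModel (M : KModel W) : Prop := M.F.IsGeneral ∧ ∀ p, M.v p ∈ M.F.P

/-- truth at a point -/
def sat (M : KModel W) : W → MF → Prop
  | x, .var p => x ∈ M.v p
  | _, .top => True
  | _, .bot => False
  | x, .neg φ => ¬ sat M x φ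
  | x, .and φ ψ => sat M x φ ∧ sat M x ψ
  | x, .dia φ => ∃ y, M.F.R x y ∧ sat M y φ

/-- a set is definable in `M` -/
def Definable (M : KModel W) (X : Set W) : Prop := ∃ φ : MF, X = {x | M.sat x φ}

/-- every internal set is definable in `M` -/
def MGenerated (M : KModel W) : Prop := ∀ X ∈ M.F.P, M.Definable X

/-- finitely `M`-generated -/
def FinMGenerated (M : KModel W) : Prop := M.MGenerated ∧ M.F.FinGenerated

/-- the σ-type of a point: all σ-formulas true at it -/
def stype (M : KModel W) (σ : Set ℕ) (x : W) : Set MF := {φ | φ.sig ⊆ σ ∧ M.sat x φ}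

/-- `x` is `Γ`-maximal in `M` -/
def MaxFor (M : KModel W) (Γ : Set MF) (x : W) : Prop :=
  (∀ γ ∈ Γ, M.sat x γ) ∧ ∀ y, M.F.R x y → (∀ γ ∈ Γ, M.sat y γ) → M.F.R y x

/-- the cluster `C(x)` is `μ`-maximal in `M` -/
def ClMuMax (M : KModel W) (μ : MF) (x : W) : Prop := ∃ z ∈ M.F.cluster x, M.MaxFor {μ} z

/-- the cluster `C(x)` is maximal in `M` -/
def ClMax (M : KModel W) (x : W) : Prop := ∃ μ : MF, M.ClMuMax μ x

/-- the cluster `C(x)` is σ-maximal in `M` -/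
def ClSigMax (M : KModel W) (σ : Set ℕ) (x : W) : Prop :=
  ∃ μ : MF, μ.sig ⊆ σ ∧ M.ClMuMax μ x

/-- the cluster `C(x)` is definable in `M` -/
def ClDefinable (M : KModel W) (x : W) : Prop := M.Definable (M.F.cluster x)

/-- `◇ t^σ_M(x) ⊆ t^σ_M(y)` -/
def diaSubset (M : KModel W) (σ : Set ℕ) (x y : W) : Prop :=
  ∀ φ ∈ M.stype σ x, MF.dia φ ∈ M.stype σ y

/-- the σ-block of a point -/
def sblockOf (M : KModel W) (σ : Set ℕ) (x : W) : Set W :=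
  {y | (M.diaSubset σ x x ∧ M.diaSubset σ y x ∧ M.diaSubset σ x y) ∨
       (¬ M.diaSubset σ x x ∧ y = x)}

/-- a σ-block in `M` -/
def IsSBlock (M : KModel W) (σ : Set ℕ) (b : Set W) : Prop := ∃ x, b = M.sblockOf σ x

/-- a degenerate σ-block in `M` -/
def DegenSBlock (M : KModel W) (σ : Set ℕ) (b : Set W) : Prop :=
  ∃ x, b = M.sblockOf σ x ∧ ¬ M.diaSubset σ x x

end KModel

/-- validity of a formula on a frame -/
def KFrame.Valid {W : Type} (F : KFrame W) (φ : MF) : Prop :=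
  ∀ v : ℕ → Set W, (∀ p, v p ∈ F.P) → ∀ x, (KModel.mk F v).sat x φ

/-- `F` is a frame for the logic `L` -/
def KFrame.IsFrameFor {W : Type} (F : KFrame W) (L : Set MF) : Prop :=
  ∀ φ ∈ L, F.Valid φ

/-! ## Bisimulations -/

def IsBisim {W₁ W₂ : Type} (σ : Set ℕ) (M₁ : KModel W₁) (M₂ : KModel W₂)
    (β : W₁ → W₂ → Prop) : Prop :=
  ∀ x₁ x₂, β x₁ x₂ →
    (∀ p ∈ σ, x₁ ∈ M₁.v p ↔ x₂ ∈ M₂.v p) ∧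
    (∀ y₁, M₁.F.R x₁ y₁ → ∃ y₂, M₂.F.R x₂ y₂ ∧ β y₁ y₂) ∧
    (∀ y₂, M₂.F.R x₂ y₂ → ∃ y₁, M₁.F.R x₁ y₁ ∧ β y₁ y₂)

def Bisimilar {W₁ W₂ : Type} (σ : Set ℕ) (M₁ : KModel W₁) (x₁ : W₁)
    (M₂ : KModel W₂) (x₂ : W₂) : Prop :=
  ∃ β, IsBisim σ M₁ M₂ β ∧ β x₁ x₂

/-- the two points satisfy the same variables of `σ` -/
def SigAgree {W₁ W₂ : Type} (σ : Set ℕ) (M₁ : KModel W₁) (x₁ : W₁)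
    (M₂ : KModel W₂) (x₂ : W₂) : Prop :=
  ∀ p ∈ σ, x₁ ∈ M₁.v p ↔ x₂ ∈ M₂.v p

/-- the two points have the same σ-type -/
def TypeEquiv {W₁ W₂ : Type} (σ : Set ℕ) (M₁ : KModel W₁) (x₁ : W₁)
    (M₂ : KModel W₂) (x₂ : W₂) : Prop :=
  ∀ φ : MF, φ.sig ⊆ σ → (M₁.sat x₁ φ ↔ M₂.sat x₂ φ)

/-! ## Interpolants -/

def IsInterpolant (L : Set MF) (φ₁ φ₂ ι : MF) : Prop :=
  ι.sig ⊆ φ₁.sig ∩ φ₂.sig ∧ MF.imp φ₁ ι ∈ L ∧ MF.imp ι φ₂ ∈ L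

def NoInterpolant (L : Set MF) (φ₁ φ₂ : MF) : Prop := ¬ ∃ ι, IsInterpolant L φ₁ φ₂ ι

def HasCIP (L : Set MF) : Prop :=
  ∀ φ₁ φ₂ : MF, MF.imp φ₁ φ₂ ∈ L → ∃ ι, IsInterpolant L φ₁ φ₂ ι

/-- `k(φ₁,φ₂) = 3 + 3·max(|φ₁|,|φ₂|)` -/
def kBound (φ₁ φ₂ : MF) : ℕ := 3 + 3 * max φ₁.size φ₂.size

/-- the conjunction of a finite list of formulas -/
def conjList : List MF → MF
  | [] => .top
  | φ :: l => .and φ (conjList l)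

/-! ## d-persistence and cofinal subframe logics -/

def DPersistent (L : Set MF) : Prop :=
  ∀ (W : Type) (F : KFrame W), F.IsGeneral → F.Descriptive → F.IsFrameFor L →
    KFrame.IsFrameFor ⟨F.R, (Set.univ : Set (Set W))⟩ L

def CofinalSet {W : Type} (F : KFrame W) (S : Set W) : Prop :=
  ∀ x ∈ S, ∀ y, F.R x y → y ∈ S ∨ ∃ z ∈ S, F.R y z

/-- the subframe of `F` with underlying set `S` and internal sets `Q` -/
def subframeOn {W : Type} (F : KFrame W) (S : Set W) (Q : Set (Set W)) : KFrame S :=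
  ⟨fun a b => F.R a.1 b.1, {T | ∃ X ∈ Q, T = (Subtype.val ⁻¹' X : Set S)}⟩

/-- the class of general frames of `L` is closed under cofinal subframes -/
def CofinalSubframeLogic (L : Set MF) : Prop :=
  ∀ (W : Type) (F : KFrame W) (S : Set W) (Q : Set (Set W)),
    F.IsGeneral → F.IsFrameFor L → Q ⊆ F.P → (∀ X ∈ Q, X ⊆ S) →
    (subframeOn F S Q).IsGeneral → CofinalSet F S →
    (subframeOn F S Q).IsFrameFor L

/-- the subframe of `F` generated by a point `x` -/
def KFrame.genSub {W : Type} (F : KFrame W) (x : W) :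
    KFrame {y : W // x = y ∨ F.R x y} :=
  ⟨fun a b => F.R a.1 b.1, {S | ∃ X ∈ F.P, S = Subtype.val ⁻¹' X}⟩

/-! ## Frames for `K4.3` -/

namespace KFrame

open scoped Topology

variable {W : Type} {F : KFrame W}

theorem exists_mem_separating (hg : F.IsGeneral) (hd : F.Descriptive) {a b : W} (hab : a ≠ b) :
    ∃ D ∈ F.P, b ∈ D ∧ a ∉ D := by
  by_contra! hn
  refine hab (hd.1 a b fun D hD => ⟨fun ha => ?_, fun hb => hn D hD hb⟩)
  by_contra hb
  exact hn Dᶜ (hg.2.2.2.2.1 D hD) hb ha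

theorem exists_mem_separating_of_not_le (hg : F.IsGeneral) (hd : F.Descriptive) {a b : W}
    (hab : ¬ (a = b ∨ F.R a b)) : ∃ X ∈ F.P, b ∈ X ∧ a ∉ X ∧ a ∉ F.dia X := by
  push Not at hab
  obtain ⟨hne, hR⟩ := hab
  rw [hd.2.1] at hR
  push Not at hR
  obtain ⟨X, hX, hbX, haX⟩ := hR
  obtain ⟨D, hD, hbD, haD⟩ := exists_mem_separating hg hd hne
  exact ⟨X ∩ D, hg.2.2.2.1 X hX D hD, ⟨hbX, hbD⟩, fun h => haD h.2,
    fun ⟨w, hw, hR⟩ => haX ⟨w, hw.1, hR⟩⟩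

theorem trans_of_isFrameFor_K43 (hg : F.IsGeneral) (hd : F.Descriptive)
    (hK : F.IsFrameFor K43) {x y z : W} (hxy : F.R x y) (hyz : F.R y z) : F.R x z := by
  rw [hd.2.1]
  intro X hX hz
  by_contra hx
  have h := hK ax4 (fun L _ h => h (by simp)) (fun _ => Xᶜ) (fun _ => hg.2.2.2.2.1 X hX) x
  simp only [ax4, MF.imp, MF.or, MF.box, KModel.sat, Set.mem_compl_iff] at h
  simp only [dia, Set.mem_ofPred_eq] at hx
  push Not at h hx
  exact h (fun w hw hwX => hx w hwX hw) y hxy z hyz hz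

theorem connected_of_isFrameFor_K43 (hg : F.IsGeneral) (hd : F.Descriptive)
    (hK : F.IsFrameFor K43) {x y z : W} (hxy : F.R x y) (hxz : F.R x z) :
    y = z ∨ F.R y z ∨ F.R z y := by
  by_contra! hcon
  obtain ⟨hne, hyz, hzy⟩ := hcon
  obtain ⟨X, hX, hzX, hyX, hyX'⟩ := exists_mem_separating_of_not_le hg hd (not_or.2 ⟨hne, hyz⟩)
  obtain ⟨Y, hY, hyY, hzY, hzY'⟩ := exists_mem_separating_of_not_le hg hd
    (not_or.2 ⟨hne.symm, hzy⟩)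
  have h := hK ax43 (fun L _ h => h (by simp)) (fun n => if n = 0 then Xᶜ else Yᶜ)
    (fun n => by
      split_ifs
      · exact hg.2.2.2.2.1 X hX
      · exact hg.2.2.2.2.1 Y hY) x
  simp only [ax43, MF.imp, MF.or, MF.box, MF.boxPlus, KModel.sat, if_true, one_ne_zero, if_false,
    Set.mem_compl_iff, not_and, not_not, not_exists] at h
  refine h (fun h' => h' y hxy (fun h => h hyX fun w hw hwX => hyX' ⟨w, hwX, hw⟩) hyY)
    z hxz (fun h => h hzY fun w hw hwY => hzY' ⟨w, hwY, hw⟩) hzX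

/-- A rooted frame for `K4.3` is linear. -/
theorem linear_of_isFrameFor_K43 (hg : F.IsGeneral) (hd : F.Descriptive)
    (hK : F.IsFrameFor K43) {r : W} (hr : F.Rooted r) (x y : W) :
    x = y ∨ F.R x y ∨ F.R y x := by
  rcases hr x with rfl | hx
  · rcases hr y with h | h
    · exact Or.inl h
    · exact Or.inr (Or.inl h)
  · rcases hr y with rfl | hy
    · exact Or.inr (Or.inr hx)
    · exact connected_of_isFrameFor_K43 hg hd hK hx hy

theorem clLE_iff {x y : W} : F.clLE x y ↔ x = y ∨ F.R x y := by
  simp only [clLE, cluster, clLT, Set.mem_insert_iff, Set.mem_ofPred_eq, eq_comm (a := y)]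
  tauto

/-! ## The topology of internal sets -/

/-- the topology generated by the internal sets -/
abbrev topology (F : KFrame W) : TopologicalSpace W := TopologicalSpace.generateFrom F.P

theorem isClosed_of_mem (hg : F.IsGeneral) {X : Set W} (hX : X ∈ F.P) :
    IsClosed[F.topology] X := by
  let _ := F.topology
  exact ⟨TopologicalSpace.isOpen_generateFrom_of_mem (hg.2.2.2.2.1 X hX)⟩

theorem compactSpace_topology (hg : F.IsGeneral) (hd : F.Descriptive) :
    @CompactSpace W F.topology := by
  let _ := F.topology
  refine compactSpace_generateFrom (S := F.P) rfl fun Q hQ hcov => ?_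
  by_contra! hcon
  obtain ⟨x, hx⟩ := hd.2.2 (compl '' Q)
    (by rintro _ ⟨X, hX, rfl⟩; exact hg.2.2.2.2.1 X (hQ hX))
    (by
      intro Y hY hfin
      have hY' : compl '' Y ⊆ Q := by
        rintro _ ⟨Z, hZ, rfl⟩
        obtain ⟨X, hX, rfl⟩ := hY hZ
        simpa using hX
      have h := hcon _ hY' (hfin.image compl)
      rw [Set.ne_univ_iff_exists_notMem] at h
      obtain ⟨a, ha⟩ := h
      refine ⟨a, fun Z hZ => ?_⟩
      by_contra haZ
      exact ha ⟨Zᶜ, ⟨Z, hZ, rfl⟩, haZ⟩)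
  have hx' : x ∈ ⋃₀ Q := by rw [hcov]; trivial
  obtain ⟨X, hX, hxX⟩ := hx'
  exact hx Xᶜ ⟨X, hX, rfl⟩ hxX

theorem isClosed_setOf_R (hg : F.IsGeneral) (hd : F.Descriptive) (x : W) :
    IsClosed[F.topology] {y | F.R x y} := by
  let _ := F.topology
  have h : {y | F.R x y} = ⋂ X ∈ {X ∈ F.P | x ∉ F.dia X}, Xᶜ := by
    ext y
    simp only [Set.mem_ofPred_eq, Set.mem_iInter, hd.2.1 x y, Set.mem_compl_iff]
    exact ⟨fun h X hX hy => hX.2 (h X hX.1 hy), fun h X hX hy => by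
      by_contra hx; exact h X ⟨hX, hx⟩ hy⟩
  rw [h]
  exact isClosed_biInter fun X hX => isClosed_of_mem hg (hg.2.2.2.2.1 X hX.1)

theorem isClosed_setOf_le (hg : F.IsGeneral) (hd : F.Descriptive) (x : W) :
    IsClosed[F.topology] {y | x = y ∨ F.R x y} := by
  let _ := F.topology
  have h : {y | x = y ∨ F.R x y} = ⋂ X ∈ {X ∈ F.P | x ∉ X ∧ x ∉ F.dia X}, Xᶜ := by
    ext y
    simp only [Set.mem_ofPred_eq, Set.mem_iInter, Set.mem_compl_iff]
    constructor
    · rintro (rfl | h) X hX hy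
      · exact hX.2.1 hy
      · exact hX.2.2 ⟨y, hy, h⟩
    · intro h
      by_contra hn
      obtain ⟨X, hX, hy, hx⟩ := exists_mem_separating_of_not_le hg hd hn
      exact h X ⟨hX, hx⟩ hy
  rw [h]
  exact isClosed_biInter fun X hX => isClosed_of_mem hg (hg.2.2.2.2.1 X hX.1)

theorem isClosed_setOf_ge (hg : F.IsGeneral) (hd : F.Descriptive) (y : W) :
    IsClosed[F.topology] {x | x = y ∨ F.R x y} := by
  let _ := F.topology
  have h : {x | x = y ∨ F.R x y} = ⋂ X ∈ {X ∈ F.P | y ∈ X}, (X ∪ F.dia X) := by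
    ext x
    simp only [Set.mem_ofPred_eq, Set.mem_iInter, Set.mem_union]
    constructor
    · rintro (rfl | h) X hX
      · exact Or.inl hX.2
      · exact Or.inr ⟨y, hX.2, h⟩
    · intro h
      by_contra hn
      obtain ⟨X, hX, hy, hx⟩ := exists_mem_separating_of_not_le hg hd hn
      exact (h X ⟨hX, hy⟩).elim hx.1 hx.2
  rw [h]
  exact isClosed_biInter fun X hX =>
    (isClosed_of_mem hg hX.1).union (isClosed_of_mem hg (hg.2.2.2.2.2 X hX.1))

end KFrame

/-- If every point of a nonempty set `D` has an `r`-bound in a closed set `K`, then some point of `K`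
is an `r`-bound of the whole of `D`. -/
theorem exists_bound_mem_of_isClosed {W : Type} [TopologicalSpace W] [CompactSpace W]
    {r : W → W → Prop} (htot : ∀ x y, r x y ∨ r y x) (htr : ∀ x y z, r x y → r y z → r x z)
    (hcl : ∀ x, IsClosed {y | r x y}) {D K : Set W} (hK : IsClosed K) (hD : D.Nonempty)
    (hDK : ∀ u ∈ D, ∃ a ∈ K, r u a) : ∃ m ∈ K, ∀ u ∈ D, r u m := by
  have : Nonempty D := hD.to_subtype
  have hclosed : ∀ u : D, IsClosed (K ∩ {y | r u y}) := fun u => hK.inter (hcl u)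
  obtain ⟨m, hm⟩ := IsCompact.nonempty_iInter_of_directed_nonempty_isCompact_isClosed
    (fun u : D => K ∩ {y | r u y})
    (by
      intro u w
      rcases htot u w with h | h
      · exact ⟨w, fun z hz => ⟨hz.1, htr _ _ _ h hz.2⟩, subset_rfl⟩
      · exact ⟨u, subset_rfl, fun z hz => ⟨hz.1, htr _ _ _ h hz.2⟩⟩)
    (fun u => hDK u u.2) (fun u => (hclosed u).isCompact) hclosed
  simp only [Set.mem_iInter] at hm
  exact ⟨m, (hm ⟨_, hD.some_mem⟩).1, fun u hu => (hm ⟨u, hu⟩).2⟩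

namespace KFrame

open scoped Topology

variable {W : Type} {F : KFrame W}

/-- descriptive frames with a transitive linear relation -/
structure LinDescriptive (F : KFrame W) : Prop where
  general : F.IsGeneral
  descriptive : F.Descriptive
  trans : ∀ {x y z}, F.R x y → F.R y z → F.R x z
  linear : ∀ x y, x = y ∨ F.R x y ∨ F.R y x

namespace LinDescriptive

theorem le_total (h : F.LinDescriptive) (x y : W) :
    (x = y ∨ F.R x y) ∨ (y = x ∨ F.R y x) := by
  rcases h.linear x y with h | h | h <;> simp [h]

theorem le_trans (h : F.LinDescriptive) (x y z : W) (hxy : x = y ∨ F.R x y)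
    (hyz : y = z ∨ F.R y z) : x = z ∨ F.R x z := by
  rcases hxy with rfl | hxy
  · exact hyz
  · rcases hyz with rfl | hyz
    · exact Or.inr hxy
    · exact Or.inr (h.trans hxy hyz)

theorem exists_bound (h : F.LinDescriptive) {D K : Set W} (hK : IsClosed[F.topology] K)
    (hD : D.Nonempty) (hDK : ∀ u ∈ D, ∃ a ∈ K, u = a ∨ F.R u a) :
    ∃ m ∈ K, ∀ u ∈ D, u = m ∨ F.R u m := by
  let _ := F.topology
  have := compactSpace_topology h.general h.descriptive
  exact exists_bound_mem_of_isClosed (r := fun x y => x = y ∨ F.R x y) h.le_total h.le_trans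
    (isClosed_setOf_le h.general h.descriptive) hK hD hDK

theorem exists_max (h : F.LinDescriptive) {K : Set W} (hK : IsClosed[F.topology] K)
    (hne : K.Nonempty) : ∃ m ∈ K, ∀ u ∈ K, u = m ∨ F.R u m :=
  h.exists_bound hK hne fun u hu => ⟨u, hu, Or.inl rfl⟩

theorem exists_min (h : F.LinDescriptive) {K : Set W} (hK : IsClosed[F.topology] K)
    (hne : K.Nonempty) : ∃ m ∈ K, ∀ u ∈ K, m = u ∨ F.R m u := by
  let _ := F.topology
  have := compactSpace_topology h.general h.descriptive
  exact exists_bound_mem_of_isClosed (r := fun x y => y = x ∨ F.R y x)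
    (fun x y => h.le_total y x) (fun x y z hxy hyz => h.le_trans z y x hyz hxy)
    (isClosed_setOf_ge h.general h.descriptive) hK hne fun u hu => ⟨u, hu, Or.inl rfl⟩

theorem not_limitCl_of_isClosed (h : F.LinDescriptive) {x : W}
    (hU : IsClosed[F.topology] {z | F.clLT x z}) : ¬ F.LimitCl x := by
  rintro ⟨hfin, hsucc⟩
  simp only [FinalCl, not_forall, not_not] at hfin
  obtain ⟨m, hm, hmin⟩ := h.exists_min hU hfin
  refine hsucc ⟨m, hm, ?_⟩
  rintro ⟨z, hxz, hzm⟩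
  rcases hmin z hxz with rfl | hmz
  · exact hzm.2 hzm.1
  · exact hzm.2 hmz

/-- In a finitely generated frame, no cluster is the limit of the clusters below it. -/
theorem exists_immediate_predecessor (h : F.LinDescriptive) (hfin : F.FinGenerated) (y : W)
    (hne : {u | F.clLT u y}.Nonempty) :
    ∃ m, F.clLT m y ∧ ∀ u, F.clLT u y → u = m ∨ F.R u m := by
  let _ := F.topology
  by_contra! hcon
  have hg := h.general
  have hnomax : ∀ u, F.clLT u y → ∃ u', F.clLT u' y ∧ F.R u u' ∧ ¬ F.R u' u := by
    intro u hu
    obtain ⟨u', hu', hne, hR⟩ := hcon u hu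
    rcases h.linear u u' with rfl | h' | h'
    · exact absurd rfl hne
    · exact ⟨u', hu', h', hR⟩
    · exact absurd h' hR
  have hlimit : ∀ A : Set W, IsClosed A →
      (∀ u, F.clLT u y → ∃ a ∈ A, F.clLT a y ∧ F.R u a) → ∃ c ∈ A, c ∈ F.cluster y := by
    intro A hA hcof
    obtain ⟨c, ⟨hcA, hcy⟩, hc⟩ := h.exists_bound
      (hA.inter (isClosed_setOf_ge hg h.descriptive y)) hne
      (fun u hu => by
        obtain ⟨a, haA, hay, hua⟩ := hcof u hu
        exact ⟨a, ⟨haA, Or.inr hay.1⟩, Or.inr hua⟩)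
    refine ⟨c, hcA, ?_⟩
    rcases hcy with rfl | hcy
    · exact Set.mem_insert _ _
    · refine Or.inr ⟨?_, hcy⟩
      by_contra hyc
      obtain ⟨u', hu', hcu', hu'c⟩ := hnomax c ⟨hcy, hyc⟩
      rcases hc u' hu' with rfl | h'
      · exact hu'c hcu'
      · exact hu'c h'
  have hyy : F.R y y := by
    by_contra hirr
    have hirr' := hirr
    rw [h.descriptive.2.1] at hirr'
    push Not at hirr'
    obtain ⟨X, hX, hyX, hyX'⟩ := hirr'
    obtain ⟨c, hcA, hcy⟩ := hlimit (X ∩ (F.dia X)ᶜ)ᶜ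
      (isClosed_of_mem hg (hg.2.2.2.2.1 _ (hg.2.2.2.1 _ hX _
        (hg.2.2.2.2.1 _ (hg.2.2.2.2.2 _ hX)))))
      (fun u hu => by
        obtain ⟨u', hu', huu', -⟩ := hnomax u hu
        exact ⟨u', fun hmem => hmem.2 ⟨y, hyX, hu'.1⟩, hu', huu'⟩)
    rcases hcy with rfl | ⟨h1, h2⟩
    · exact hcA ⟨hyX, hyX'⟩
    · exact hirr (h.trans h1 h2)
  have hcl : ∀ c, c ∈ F.cluster y → F.R y c ∧ F.R c y := by
    rintro c (rfl | hc)
    · exact ⟨hyy, hyy⟩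
    · exact hc
  obtain ⟨G, hG, hGP⟩ := hfin
  have hclosedG : ∀ X ∈ G, X ∈ F.P := fun X hX => by rw [hGP]; exact genBy.basic hX
  let atom : W → Set (Set W) := fun z => {X ∈ G | z ∈ X}
  have hatom_closed : ∀ S : Set (Set W), IsClosed {z | atom z = S} := by
    intro S
    by_cases hS : S ⊆ G
    · have : {z | atom z = S} = ⋂ X ∈ G, {z | z ∈ X ↔ X ∈ S} := by
        ext z
        simp only [Set.mem_ofPred_eq, Set.mem_iInter, atom, Set.ext_iff]
        exact ⟨fun hz X hX => by simpa [hX] using hz X,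
          fun hz X => ⟨fun hX => (hz X hX.1).1 hX.2, fun hX => ⟨hS hX, (hz X (hS hX)).2 hX⟩⟩⟩
      rw [this]
      refine isClosed_biInter fun X hX => ?_
      by_cases hXS : X ∈ S
      · simpa [hXS] using isClosed_of_mem hg (hclosedG X hX)
      · simp only [hXS, iff_false]
        exact isClosed_of_mem hg (hg.2.2.2.2.1 X (hclosedG X hX))
    · have : {z | atom z = S} = ∅ := by
        ext z
        simp only [Set.mem_ofPred_eq, Set.mem_empty_iff_false, iff_false]
        rintro rfl
        exact hS fun X hX => hX.1
      rw [this]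
      exact isClosed_empty
  have hbad : IsClosed {z | ∀ c ∈ F.cluster y, atom z ≠ atom c} := by
    have : {z | ∀ c ∈ F.cluster y, atom z ≠ atom c} =
        ⋃ S ∈ {S ∈ 𝒫 G | ∀ c ∈ F.cluster y, S ≠ atom c}, {z | atom z = S} := by
      ext z
      simp only [Set.mem_ofPred_eq, Set.mem_iUnion, exists_prop]
      exact ⟨fun hz => ⟨atom z, ⟨fun X hX => hX.1, hz⟩, rfl⟩, fun ⟨S, hS, hz⟩ => hz ▸ hS.2⟩
    rw [this]
    exact (hG.powerset.subset (Set.sep_subset _ _)).isClosed_biUnion fun S _ => hatom_closed S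
  obtain ⟨u₀, hu₀, hgood⟩ : ∃ u₀, F.clLT u₀ y ∧
      ∀ a, F.clLT a y → F.R u₀ a → ∃ c ∈ F.cluster y, atom a = atom c := by
    by_contra! hn
    obtain ⟨c, hc, hcy⟩ := hlimit _ hbad fun u hu => by
      obtain ⟨a, ha, hua, hac⟩ := hn u hu
      exact ⟨a, hac, ha, hua⟩
    exact hc c hcy rfl
  have hagree : ∀ X, genBy F.R G X → ∀ u c, F.clLT u y → F.R u₀ u → c ∈ F.cluster y →
      atom u = atom c → (u ∈ X ↔ c ∈ X) := by
    intro X hX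
    induction hX with
    | @basic X hX =>
      intro u c _ _ _ hat
      have := Set.ext_iff.1 hat X
      simpa [atom, hX] using this
    | empty => intros; simp
    | univ => intros; simp
    | inter _ _ ih₁ ih₂ =>
      intro u c hu hu' hc hat
      exact and_congr (ih₁ u c hu hu' hc hat) (ih₂ u c hu hu' hc hat)
    | compl _ ih =>
      intro u c hu hu' hc hat
      exact not_congr (ih u c hu hu' hc hat)
    | dia _ ih =>
      intro u c hu hu' hc hat
      constructor
      · rintro ⟨w, hw, huw⟩
        by_cases hwy : F.clLT w y
        · obtain ⟨c', hc', hat'⟩ := hgood w hwy (h.trans hu' huw)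
          exact ⟨c', (ih w c' hwy (h.trans hu' huw) hc' hat').1 hw,
            h.trans (hcl c hc).2 (hcl c' hc').1⟩
        · refine ⟨w, hw, h.trans (hcl c hc).2 ?_⟩
          rcases h.linear w y with rfl | h' | h'
          · exact hyy
          · by_contra hn
            exact hwy ⟨h', hn⟩
          · exact h'
      · rintro ⟨w, hw, hcw⟩
        exact ⟨w, hw, h.trans hu.1 (h.trans (hcl c hc).1 hcw)⟩
  obtain ⟨u, hu, hu₀u, -⟩ := hnomax u₀ hu₀
  obtain ⟨c, hc, hat⟩ := hgood u hu hu₀u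
  have huc : u = c := h.descriptive.1 u c fun X hX =>
    hagree X (by rw [hGP] at hX; exact hX) u c hu hu₀u hc hat
  exact hu.2 (huc ▸ (hcl c hc).1)

end LinDescriptive

end KFrame

/-! ## Types and blocks -/

namespace KModel

open scoped Topology

variable {W : Type} {M : KModel W} {σ : Set ℕ}

theorem IsModel.setOf_sat_mem (hM : M.IsModel) (φ : MF) : {x | M.sat x φ} ∈ M.F.P := by
  induction φ with
  | var p => exact hM.2 p
  | top => simpa [sat] using hM.1.2.2.1
  | bot => simpa [sat] using hM.1.2.1
  | neg φ ih => exact hM.1.2.2.2.2.1 _ ih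
  | and φ ψ ih₁ ih₂ => exact hM.1.2.2.2.1 _ ih₁ _ ih₂
  | dia φ ih =>
    have := hM.1.2.2.2.2.2 _ ih
    convert this using 1
    ext x
    simp [sat, KFrame.dia, and_comm]

theorem IsModel.isClosed_setOf_sat (hM : M.IsModel) (φ : MF) :
    IsClosed[M.F.topology] {x | M.sat x φ} :=
  KFrame.isClosed_of_mem hM.1 (hM.setOf_sat_mem φ)

theorem diaSubset_iff {x y : W} :
    M.diaSubset σ x y ↔ ∀ φ : MF, φ.sig ⊆ σ → M.sat x φ → ∃ z, M.F.R y z ∧ M.sat z φ :=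
  ⟨fun h φ hφ hx => (h φ ⟨hφ, hx⟩).2, fun h φ hφ => ⟨hφ.1, h φ hφ.1 hφ.2⟩⟩

theorem diaSubset_congr_right {x y z : W} (h : M.stype σ y = M.stype σ z) :
    M.diaSubset σ x y ↔ M.diaSubset σ x z := by
  simp only [diaSubset, h]

theorem diaSubset_congr_left {x y z : W} (h : M.stype σ y = M.stype σ z) :
    M.diaSubset σ y x ↔ M.diaSubset σ z x := by
  simp only [diaSubset, h]

theorem diaSubset.trans (hF : M.F.LinDescriptive) {x y z : W} (hxy : M.diaSubset σ x y)
    (hyz : M.diaSubset σ y z) : M.diaSubset σ x z := by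
  rw [diaSubset_iff] at *
  intro φ hφ hx
  obtain ⟨w, hzw, v, hwv, hv⟩ := hyz (.dia φ) hφ (hxy φ hφ hx)
  exact ⟨v, hF.trans hzw hwv, hv⟩

theorem diaSubset.le_right (hF : M.F.LinDescriptive) {x y z : W} (hxy : M.diaSubset σ x y)
    (hzy : z = y ∨ M.F.R z y) : M.diaSubset σ x z := by
  rcases hzy with rfl | hzy
  · exact hxy
  rw [diaSubset_iff] at *
  intro φ hφ hx
  obtain ⟨w, hyw, hw⟩ := hxy φ hφ hx
  exact ⟨w, hF.trans hzy hyw, hw⟩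

theorem diaSubset.le_left (hF : M.F.LinDescriptive) {x y z : W} (hxy : M.diaSubset σ x y)
    (hxz : x = z ∨ M.F.R x z) : M.diaSubset σ z y := by
  rcases hxz with rfl | hxz
  · exact hxy
  rw [diaSubset_iff] at *
  intro φ hφ hz
  obtain ⟨w, hyw, v, hwv, hv⟩ := hxy (.dia φ) hφ ⟨z, hxz, hz⟩
  exact ⟨v, hF.trans hyw hwv, hv⟩

theorem IsModel.isClosed_setOf_diaSubset_right (hM : M.IsModel) (x : W) :
    IsClosed[M.F.topology] {y | M.diaSubset σ x y} := by
  let _ := M.F.topology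
  have : {y | M.diaSubset σ x y} = ⋂ φ ∈ M.stype σ x, {y | M.sat y (.dia φ)} := by
    ext y
    simp only [Set.mem_ofPred_eq, Set.mem_iInter]
    exact ⟨fun h φ hφ => (h φ hφ).2, fun h φ hφ => ⟨hφ.1, h φ hφ⟩⟩
  rw [this]
  exact isClosed_biInter fun φ _ => hM.isClosed_setOf_sat _

theorem IsModel.isClosed_setOf_diaSubset_left (hM : M.IsModel) (x : W) :
    IsClosed[M.F.topology] {y | M.diaSubset σ y x} := by
  let _ := M.F.topology
  have : {y | M.diaSubset σ y x} =
      ⋂ φ ∈ {φ : MF | φ.sig ⊆ σ ∧ ¬ M.sat x (.dia φ)}, {y | M.sat y (.neg φ)} := by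
    ext y
    simp only [Set.mem_ofPred_eq, Set.mem_iInter, diaSubset_iff]
    exact ⟨fun h φ hφ hy => hφ.2 (h φ hφ.1 hy), fun h φ hφ hy => by
      by_contra hx; exact h φ ⟨hφ, hx⟩ hy⟩
  rw [this]
  exact isClosed_biInter fun φ _ => hM.isClosed_setOf_sat _

/-- If `◇t(y) ⊆ t(x)`, then the type of `y` is realized in some successor of `x`. -/
theorem diaSubset.exists_stype_eq (hM : M.IsModel) (hd : M.F.Descriptive) {x y : W}
    (hyx : M.diaSubset σ y x) : ∃ z, M.F.R x z ∧ M.stype σ z = M.stype σ y := by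
  let _ := M.F.topology
  have := KFrame.compactSpace_topology hM.1 hd
  have : Nonempty (M.stype σ y) := ⟨⟨.top, by simp [stype, MF.sig, MF.vars, sat]⟩⟩
  have hclosed : ∀ φ : M.stype σ y, IsClosed ({z | M.F.R x z} ∩ {z | M.sat z φ}) :=
    fun φ => (KFrame.isClosed_setOf_R hM.1 hd x).inter (hM.isClosed_setOf_sat _)
  obtain ⟨z, hz⟩ := IsCompact.nonempty_iInter_of_directed_nonempty_isCompact_isClosed
    (fun φ : M.stype σ y => {z | M.F.R x z} ∩ {z | M.sat z φ})
    (fun φ ψ => ⟨⟨.and φ ψ, by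
        simpa [MF.sig, MF.vars] using ⟨φ.2.1, ψ.2.1⟩, φ.2.2, ψ.2.2⟩,
      fun z hz => ⟨hz.1, hz.2.1⟩, fun z hz => ⟨hz.1, hz.2.2⟩⟩)
    (fun φ => (hyx φ φ.2).2) (fun φ => (hclosed φ).isCompact) hclosed
  simp only [Set.mem_iInter] at hz
  refine ⟨z, (hz (Classical.arbitrary _)).1, Set.ext fun φ => ⟨fun hφ => ⟨hφ.1, ?_⟩,
    fun hφ => ⟨hφ.1, (hz ⟨φ, hφ⟩).2⟩⟩⟩
  by_contra hn
  exact (hz ⟨.neg φ, hφ.1, hn⟩).2 hφ.2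

theorem sblockOf_of_diaSubset {x : W} (hx : M.diaSubset σ x x) :
    M.sblockOf σ x = {y | M.diaSubset σ y x ∧ M.diaSubset σ x y} := by
  ext y
  simp [sblockOf, hx]

theorem sblockOf_of_not_diaSubset {x : W} (hx : ¬ M.diaSubset σ x x) :
    M.sblockOf σ x = {x} := by
  ext y
  simp [sblockOf, hx]

theorem isClosed_setOf_clLT_of_clMuMax (hM : M.IsModel) (hF : M.F.LinDescriptive) {x : W} {μ : MF}
    (hμ : M.ClMuMax μ x) : IsClosed[M.F.topology] {z | M.F.clLT x z} := by
  let _ := M.F.topology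
  obtain ⟨m, hm, hmμ, hmax⟩ := hμ
  simp only [Set.mem_singleton_iff, forall_eq] at hmμ hmax
  have hxm : x = m ∨ M.F.R x m := hm.imp Eq.symm And.left
  have hmx : m = x ∨ M.F.R m x := hm.imp id And.right
  have : {z | M.F.clLT x z} =
      ({z | M.F.R x z} ∩ {z | M.sat z (.neg μ)}) ∩ {z | M.sat z (.neg (.dia μ))} := by
    ext z
    have hle : ∀ {w}, M.F.R x w → M.F.R m w := fun {w} h => by
      rcases hmx with rfl | h'
      exacts [h, hF.trans h' h]
    have hge : ∀ {w}, M.F.R w m → M.F.R w x := fun {w} h => by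
      rcases hmx with rfl | h'
      exacts [h, hF.trans h h']
    have hge' : ∀ {w}, M.F.R w x → M.F.R w m := fun {w} h => by
      rcases hxm with rfl | h'
      exacts [h, hF.trans h h']
    constructor
    · rintro ⟨hxz, hzx⟩
      refine ⟨⟨hxz, fun hz => hzx (hge (hmax z (hle hxz) hz))⟩, ?_⟩
      rintro ⟨w, hzw, hw⟩
      exact hzx (hge (hF.trans hzw (hmax w (hle (hF.trans hxz hzw)) hw)))
    · rintro ⟨⟨hxz, -⟩, hz⟩
      exact ⟨hxz, fun hzx => hz ⟨m, hge' hzx, hmμ⟩⟩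
  rw [this]
  exact ((KFrame.isClosed_setOf_R hM.1 hF.descriptive x).inter (hM.isClosed_setOf_sat _)).inter
    (hM.isClosed_setOf_sat _)

/-- The structure of a degenerate block. -/
theorem sblockOf_degenerate (hM : M.IsModel) (hF : M.F.LinDescriptive) {x : W}
    (hx : ¬ M.diaSubset σ x x) :
    M.F.cluster x = {x} ∧ M.ClSigMax σ x ∧ M.Definable {x} ∧ ¬ M.F.LimitCl x := by
  have hx' := hx
  rw [diaSubset_iff] at hx'
  push Not at hx'
  obtain ⟨φ, hφσ, hφ, hnφ⟩ := hx'
  have hirr : ¬ M.F.R x x := fun h => hnφ x h hφ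
  refine ⟨?_, ⟨φ, hφσ, x, Set.mem_insert _ _, ?_, ?_⟩, ⟨.and φ (.neg (.dia φ)), ?_⟩, ?_⟩
  · ext z
    simp only [KFrame.cluster, Set.mem_insert_iff, Set.mem_ofPred_eq, Set.mem_singleton_iff,
      or_iff_left_iff_imp]
    exact fun hz => absurd (hF.trans hz.1 hz.2) hirr
  · simpa using hφ
  · exact fun y hy h => absurd (h φ rfl) (hnφ y hy)
  · ext z
    simp only [Set.mem_singleton_iff, Set.mem_ofPred_eq, sat]
    constructor
    · rintro rfl
      exact ⟨hφ, fun ⟨w, hw, hw'⟩ => hnφ w hw hw'⟩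
    · rintro ⟨hz, hnz⟩
      rcases hF.linear z x with h | h | h
      · exact h
      · exact absurd ⟨x, h, hφ⟩ hnz
      · exact absurd hz (hnφ z h)
  · refine hF.not_limitCl_of_isClosed ?_
    convert KFrame.isClosed_setOf_R hM.1 hF.descriptive x using 3 with z
    exact and_iff_left_of_imp fun h h' => hirr (hF.trans h h')

end KModel

/-- the structure of σ-blocks (Lemma `int-prop`): every σ-block `b` is a
closed interval of clusters `[C⁻_b, C⁺_b]` with the stated properties. -/
theorem sblock_structure (W : Type) (M : KModel W) (hM : M.IsModel)
    (hroot : ∃ r, M.F.Rooted r) (hd : M.F.Descriptive) (hfg : M.FinMGenerated)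
    (hK : M.F.IsFrameFor K43) (σ : Set ℕ) (b : Set W) (hb : M.IsSBlock σ b) :
    ∃ cm cp : W,
      b = M.F.interval cm cp ∧
      (M.ClMax cp → M.ClSigMax σ cp) ∧
      (¬ M.F.R cp cp → b = M.F.cluster cp) ∧
      (M.Definable b ↔ ¬ M.F.LimitCl cp) ∧
      {t : Set MF | ∃ y ∈ b, t = M.stype σ y} =
        {t : Set MF | ∃ y ∈ M.F.cluster cp, t = M.stype σ y} := by
  obtain ⟨r, hr⟩ := hroot
  have hF : M.F.LinDescriptive :=
    ⟨hM.1, hd, KFrame.trans_of_isFrameFor_K43 hM.1 hd hK,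
      KFrame.linear_of_isFrameFor_K43 hM.1 hd hK hr⟩
  have hinterval : ∀ x y z : W, z ∈ M.F.interval x y ↔
      (x = z ∨ M.F.R x z) ∧ (z = y ∨ M.F.R z y) := fun x y z =>
    and_congr KFrame.clLE_iff KFrame.clLE_iff
  obtain ⟨x, rfl⟩ := hb
  by_cases hx : M.diaSubset σ x x
  swap
  · obtain ⟨hcl, hmax, hdef, hlim⟩ := KModel.sblockOf_degenerate hM hF hx
    rw [KModel.sblockOf_of_not_diaSubset hx]
    refine ⟨x, x, ?_, fun _ => hmax, fun _ => hcl.symm, iff_of_true hdef hlim, by rw [hcl]⟩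
    rw [← hcl]
    ext z
    rw [hinterval]
    simp only [KFrame.cluster, Set.mem_insert_iff, Set.mem_ofPred_eq, eq_comm (a := x)]
    tauto
  rw [KModel.sblockOf_of_diaSubset hx]
  set b := {y | M.diaSubset σ y x ∧ M.diaSubset σ x y}
  let _ := M.F.topology
  have hclosed : IsClosed b :=
    (hM.isClosed_setOf_diaSubset_left x).inter (hM.isClosed_setOf_diaSubset_right x)
  obtain ⟨cp, hcp, hmax⟩ := hF.exists_max hclosed ⟨x, hx, hx⟩
  obtain ⟨cm, hcm, hmin⟩ := hF.exists_min hclosed ⟨x, hx, hx⟩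
  have hmem : ∀ z, z ∈ b ↔ (cm = z ∨ M.F.R cm z) ∧ (z = cp ∨ M.F.R z cp) := fun z =>
    ⟨fun hz => ⟨hmin z hz, hmax z hz⟩,
      fun hz => ⟨hcm.1.le_left hF hz.1, hcp.2.le_right hF hz.2⟩⟩
  have hreal : ∀ y ∈ b, ∃ z, M.F.R cp z ∧ M.F.R z cp ∧ M.stype σ z = M.stype σ y := by
    intro y hy
    obtain ⟨z, hz, hzy⟩ := (hy.1.trans hF hcp.2).exists_stype_eq hM hd
    have hzb : z ∈ b := ⟨(KModel.diaSubset_congr_left hzy).2 hy.1,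
      (KModel.diaSubset_congr_right hzy).2 hy.2⟩
    refine ⟨z, hz, ?_, hzy⟩
    rcases hmax z hzb with rfl | h
    exacts [hz, h]
  have hrefl : M.F.R cp cp := by
    obtain ⟨z, h₁, h₂, -⟩ := hreal cp hcp
    exact hF.trans h₁ h₂
  have hupper : ¬ M.F.LimitCl cp → ∃ α : MF, α.sig ⊆ σ ∧
      (∀ z, z = cp ∨ M.F.R z cp → M.sat z α) ∧ ∀ z, M.F.clLT cp z → ¬ M.sat z α := by
    intro hlim
    by_cases hfin : M.F.FinalCl cp
    · exact ⟨.top, by simp [MF.sig, MF.vars], fun _ _ => trivial, fun z hz => absurd hz (hfin z)⟩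
    obtain ⟨y, hy, hno⟩ : ∃ y, M.F.ImmSucc cp y := by
      by_contra hn
      exact hlim ⟨hfin, hn⟩
    have hyx : ¬ M.diaSubset σ x y := fun h => by
      rcases hmax y ⟨hcp.1.le_left hF (Or.inr hy.1), h⟩ with rfl | h
      exacts [hy.2 hy.1, hy.2 h]
    rw [KModel.diaSubset_iff] at hyx
    push Not at hyx
    obtain ⟨φ, hφσ, hφ, hnφ⟩ := hyx
    refine ⟨.dia φ, hφσ, fun z hz => (hcp.2.le_right hF hz φ ⟨hφσ, hφ⟩).2, ?_⟩
    rintro z hz ⟨w, hzw, hw⟩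
    refine hnφ w ?_ hw
    rcases hF.linear y z with rfl | h | h
    · exact hzw
    · exact hF.trans h hzw
    · by_contra hyw
      exact hno ⟨z, hz, h, fun h' => hyw (hF.trans h' hzw)⟩
  have hlower : ∃ β : MF, (∀ z, M.F.clLT z cm → M.sat z β) ∧ ∀ z ∈ b, ¬ M.sat z β := by
    by_cases hne : {u | M.F.clLT u cm}.Nonempty
    swap
    · exact ⟨.bot, fun z hz => absurd ⟨z, hz⟩ hne, fun _ _ h => h⟩
    obtain ⟨m, hm, hmmax⟩ := hF.exists_immediate_predecessor hfg.2 cm hne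
    have hmx : ¬ M.diaSubset σ m x := fun h => by
      rcases hmin m ⟨h, hcm.2.le_right hF (Or.inr hm.1)⟩ with rfl | h
      exacts [hm.2 hm.1, hm.2 h]
    rw [KModel.diaSubset_iff] at hmx
    push Not at hmx
    obtain ⟨ψ, hψσ, hψ, hnψ⟩ := hmx
    refine ⟨MF.diaPlus ψ, fun z hz => ?_, fun z hz => ?_⟩
    · simp only [MF.diaPlus, MF.or, KModel.sat]
      rintro ⟨h₁, h₂⟩
      rcases hmmax z hz with rfl | h
      exacts [h₁ hψ, h₂ ⟨m, h, hψ⟩]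
    · simp only [MF.diaPlus, MF.or, KModel.sat, not_not]
      refine ⟨fun h => ?_, fun ⟨w, hzw, hw⟩ => ?_⟩
      · obtain ⟨w, hxw, hw⟩ := (hz.1 ψ ⟨hψσ, h⟩).2
        exact hnψ w hxw hw
      · obtain ⟨v, hxv, hv⟩ := (hz.1.le_left hF (Or.inr hzw) ψ ⟨hψσ, hw⟩).2
        exact hnψ v hxv hv
  refine ⟨cm, cp, ?_, ?_, fun h => absurd hrefl h, ⟨?_, ?_⟩, ?_⟩
  · ext z
    rw [hmem, hinterval]
  · rintro ⟨μ, hμ⟩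
    obtain ⟨α, hασ, hα, hnα⟩ := hupper
      (hF.not_limitCl_of_isClosed (KModel.isClosed_setOf_clLT_of_clMuMax hM hF hμ))
    refine ⟨α, hασ, cp, Set.mem_insert _ _, by simpa using hα cp (Or.inl rfl), fun y hy h => ?_⟩
    by_contra hn
    exact hnα y ⟨hy, hn⟩ (h α rfl)
  · rintro ⟨β, hβ⟩
    refine hF.not_limitCl_of_isClosed ?_
    have : {z | M.F.clLT cp z} = {z | M.F.R cp z} ∩ {z | M.sat z (.neg β)} := by
      ext z
      have hzβ : z ∈ b ↔ M.sat z β := by rw [hβ]; rfl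
      simp only [KFrame.clLT, Set.mem_ofPred_eq, Set.mem_inter_iff, KModel.sat, ← hzβ]
      refine and_congr_right fun hz => not_congr ⟨fun h => (hmem z).2 ⟨?_, Or.inr h⟩, fun h => ?_⟩
      · exact hF.le_trans _ _ _ (hmin cp hcp) (Or.inr hz)
      · rcases hmax z h with rfl | h
        exacts [hz, h]
    rw [this]
    exact (KFrame.isClosed_setOf_R hM.1 hd cp).inter (hM.isClosed_setOf_sat _)
  · intro hlim
    obtain ⟨α, -, hα, hnα⟩ := hupper hlim
    obtain ⟨β, hβ, hnβ⟩ := hlower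
    refine ⟨.and α (.neg β), ?_⟩
    ext z
    refine ⟨fun hz => ⟨hα z (hmax z hz), hnβ z hz⟩, fun ⟨h₁, h₂⟩ => (hmem z).2 ⟨?_, ?_⟩⟩
    · rcases hF.linear cm z with h | h | h
      · exact Or.inl h
      · exact Or.inr h
      · by_contra hn
        exact h₂ (hβ z ⟨h, fun h' => hn (Or.inr h')⟩)
    · rcases hF.linear z cp with h | h | h
      · exact Or.inl h
      · exact Or.inr h
      · by_contra hn
        exact hnα z ⟨h, fun h' => hn (Or.inr h')⟩ h₁
  · ext t
    constructor
    · rintro ⟨y, hy, rfl⟩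
      obtain ⟨z, h₁, h₂, hz⟩ := hreal y hy
      exact ⟨z, Or.inr ⟨h₁, h₂⟩, hz.symm⟩
    · rintro ⟨y, hy, rfl⟩
      refine ⟨y, (hmem y).2 ⟨?_, hy.imp id And.right⟩, rfl⟩
      exact hF.le_trans _ _ _ (hmin cp hcp) (hy.imp Eq.symm And.left)
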